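/- Let J be a unital Jordan algebra over a field F of characteristic different from 2 and 3, let d be a derivation with invertible values of J, and let I be a proper ideal of J with d(I) ≠ 0 (i.e., I is not contained in ker d). Then I is a maximal ideal: every proper ideal I₂ of J with I ⊆ I₂ satisfies I₂ = I. -/

import Mathlib

/-- From Kaygorodov–Lopatin–Popov: Jordan algebras admitting derivations with invertible values. -/
theorem jordan_der_inv_values_ideal_maximal (F : Type*) [Field F] (h2 : (2 : F) ≠ 0) (h3 : (3 : F) ≠ 0)
    (J : Type*) [NonAssocRing J] [Module F J] [SMulCommClass F J J] [IsScalarTower F J J]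
    (hcomm : ∀ x y : J, x * y = y * x)
    (hjordan : ∀ x y : J, ((x * x) * y) * x = (x * x) * (y * x))
    (d : J →ₗ[F] J) (hder : ∀ a b : J, d (a * b) = d a * b + a * d b)
    (hd0 : d ≠ 0)
    (hdinv : ∀ x : J, d x = 0 ∨ ∃ y : J, d x * y = 1 ∧ (d x * d x) * y = d x)
    (I : Submodule F J) (hideal : ∀ x ∈ I, ∀ j : J, j * x ∈ I) (hproper : I ≠ ⊤)
    (hdI : ∃ x ∈ I, d x ≠ 0) :
    ∀ I₂ : Submodule F J, (∀ x ∈ I₂, ∀ j : J, j * x ∈ I₂) → I₂ ≠ ⊤ → I ≤ I₂ → I₂ = I := by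
  intro I₂ hI₂ hne hle
  have key : ∀ x, d x ∈ I₂ → d x = 0 := by
    intro x hx
    rcases hdinv x with h | ⟨y, hy, _⟩
    · exact h
    · exfalso
      apply hne
      rw [Submodule.eq_top_iff']
      intro z
      have h1 : (1 : J) ∈ I₂ := by
        rw [← hy, hcomm]
        exact hI₂ _ hx y
      simpa using hI₂ _ h1 z
  obtain ⟨a, ha, hda⟩ := hdI
  obtain ⟨y, hy, _⟩ := (hdinv a).resolve_left hda
  refine le_antisymm ?_ hle
  intro b hb
  have h1 : (1 : J) = d (y * a) - d y * a := by
    rw [hder, add_sub_cancel_left, hcomm, hy]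
  have hu : y * a ∈ I := hideal a ha y
  have hb2 : b = d (b * (y * a)) - d b * (y * a) - b * (d y * a) := by
    rw [hder b (y * a), add_sub_cancel_left, ← mul_sub, ← h1, mul_one]
  have hi : d b * (y * a) + b * (d y * a) ∈ I :=
    I.add_mem (hideal _ hu _) (hideal _ (hideal _ ha _) _)
  have hd : d (b * (y * a)) = b + (d b * (y * a) + b * (d y * a)) := by
    nth_rewrite 2 [hb2]
    abel
  have hz := key (b * (y * a)) (by rw [hd]; exact I₂.add_mem hb (hle hi))
  rw [hd] at hz
  rw [eq_neg_of_add_eq_zero_left hz]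
  exact I.neg_mem hi
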